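/- (Dehornoy) If a ∈ W is a word of depth at most k, then a·u_k ≡ u_{k+1}. -/

import Mathlib

/-- The free magma on one generator: words built from `1` using `·`. -/
inductive W : Type
  | one : W
  | mul : W → W → W

/-- The smallest congruence on `W` containing all instances of the
left distributive law `a·(b·c) = (a·b)·(a·c)`. -/
inductive LDEq : W → W → Prop
  | refl (a : W) : LDEq a a
  | symm {a b : W} : LDEq a b → LDEq b a
  | trans {a b c : W} : LDEq a b → LDEq b c → LDEq a c
  | congr {a a' b b' : W} : LDEq a a' → LDEq b b' → LDEq (a.mul b) (a'.mul b')
  | ld (a b c : W) : LDEq (a.mul (b.mul c)) ((a.mul b).mul (a.mul c))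

/-- The depth of a word: `depth 1 = 0`, `depth (a·b) = max (depth a) (depth b) + 1`. -/
def W.depth : W → ℕ
  | W.one => 0
  | W.mul a b => max a.depth b.depth + 1

/-- The herringbones: `u_0 = 1`, `u_{k+1} = 1·u_k`. -/
def herring : ℕ → W
  | 0 => W.one
  | k + 1 => W.mul W.one (herring k)

theorem stmt_4 (k : ℕ) (a : W) (h : a.depth ≤ k) :
    LDEq (a.mul (herring k)) (herring (k + 1)) := by
  induction a generalizing k with
  | one => exact .refl _
  | mul b c ihb ihc =>
    obtain _ | m := k
    · simp [W.depth] at h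
    have hb : b.depth ≤ m := by simp only [W.depth] at h; omega
    have hc : c.depth ≤ m := by simp only [W.depth] at h; omega
    exact (((LDEq.refl (b.mul c)).congr (ihb m hb).symm).trans (.symm (.ld b c (herring m)))).trans
      (((LDEq.refl b).congr (ihc m hc)).trans (ihb (m + 1) (by omega)))
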